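/- Let n, m ≥ 1 be integers and let {k_t}_{t=1}^∞ be an arbitrary sequence of weight vectors k_t = (k_1^{(t)},…,k_n^{(t)}) (so k_j^{(t)} > 0 for all j and Σ_{j=1}^n k_j^{(t)} = 1 for every t). If L is an n×m real matrix with L ∈ Bad(k_t,n,m) for every t ∈ ℕ, then the countable intersection ∩_{t=1}^∞ Bad_L(k_t,n,m) has full Hausdorff dimension n. -/

import Mathlib

/-- Distance from a real number to the nearest integer. -/
noncomputable def dni (x : ℝ) : ℝ := |x - round x|

/-- Supremum norm of an integer vector, as a real number. -/
noncomputable def snorm {d : ℕ} (q : Fin d → ℤ) : ℝ := ⨆ i, |(q i : ℝ)|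

/-- Euclidean norm of an integer vector. -/
noncomputable def enorm {d : ℕ} (u : Fin d → ℤ) : ℝ := Real.sqrt (∑ j, ((u j : ℝ)) ^ 2)

/-- `L ∈ Bad(k, n, m)`:  inf over nonzero integer vectors `q` of
`max_j |q|_∞^{m k_j} ‖L_j(q)‖` is positive. -/
def badForm {n m : ℕ} (k : Fin n → ℝ) (L : Matrix (Fin n) (Fin m) ℝ) : Prop :=
  ∃ ε > (0 : ℝ), ∀ q : Fin m → ℤ, q ≠ 0 →
    ∃ j : Fin n, ε ≤ snorm q ^ ((m : ℝ) * k j) * dni (∑ i, (q i : ℝ) * L j i)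

/-- The twisted set `Bad_L(k, n, m) ⊆ [0,1)^n`. -/
def badTwisted {n m : ℕ} (k : Fin n → ℝ) (L : Matrix (Fin n) (Fin m) ℝ) :
    Set (Fin n → ℝ) :=
  {α | (∀ j, α j ∈ Set.Ico (0 : ℝ) 1) ∧ ∃ ε > (0 : ℝ), ∀ q : Fin m → ℤ, q ≠ 0 →
    ∃ j : Fin n, ε ≤ snorm q ^ ((m : ℝ) * k j) * dni ((∑ i, (q i : ℝ) * L j i) - α j)}


/-- Scaled coordinates of an integer point. -/
noncomputable def sc {n m : ℕ} (L : Matrix (Fin n) (Fin m) ℝ) (Q : ℝ) (D : Fin n → ℝ)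
    (z : Fin m ⊕ Fin n → ℤ) : Fin m ⊕ Fin n → ℝ :=
  Sum.elim (fun i => Q⁻¹ * z (Sum.inl i))
    (fun j => D j * ((∑ i, (z (Sum.inl i) : ℝ) * L j i) - z (Sum.inr j)))

lemma sc_sub {n m : ℕ} (L : Matrix (Fin n) (Fin m) ℝ) (Q : ℝ) (D : Fin n → ℝ)
    (z z' : Fin m ⊕ Fin n → ℤ) : sc L Q D (z - z') = sc L Q D z - sc L Q D z' := by
  funext a
  rcases a with i | j
  · simp [sc, mul_sub]
  · simp only [sc, Sum.elim_inr, Pi.sub_apply, Int.cast_sub, sub_mul, Finset.sum_sub_distrib]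
    ring

lemma many_points {n m : ℕ} (L : Matrix (Fin n) (Fin m) ℝ) (Q : ℝ) (D : Fin n → ℝ)
    (hQ : 0 < Q) (hprod : ∏ j, D j = Q ^ m) (T : ℕ) (hT : 1 ≤ T) (hD : ∀ j, (T : ℝ) ≤ D j) :
    ∃ F : Finset (Fin m ⊕ Fin n → ℤ), (T : ℝ) ^ (m + n) / 2 ^ n ≤ F.card ∧
      ∀ z ∈ F, ∀ a, |sc L Q D z a| ≤ T := by
  classical
  have hT0 : (0 : ℝ) < T := by exact_mod_cast hT
  have hD0 : ∀ j, 0 < D j := fun j => hT0.trans_le (hD j)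
  set P := ⌊(T : ℝ) * Q⌋₊ with hP
  set N : Fin n → ℕ := fun j => ⌈D j / T⌉₊ with hN
  have hNpos : ∀ j, 0 < N j := fun j => Nat.ceil_pos.2 (div_pos (hD0 j) hT0)
  have hNle : ∀ j, (N j : ℝ) ≤ 2 * D j / T := by
    intro j
    have h1 := (Nat.ceil_lt_add_one (div_pos (hD0 j) hT0).le).le
    have h2 : 1 ≤ D j / T := by rw [le_div_iff₀ hT0]; linarith [hD j]
    calc (N j : ℝ) ≤ D j / T + 1 := h1
      _ ≤ 2 * D j / T := by rw [mul_div_assoc]; linarith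
  have hNge : ∀ j, D j / T ≤ N j := fun j => Nat.le_ceil _
  let Lq : (Fin m → ℕ) → Fin n → ℝ := fun q j => ∑ i, (q i : ℝ) * L j i
  let S : Finset (Fin m → ℕ) := Fintype.piFinset fun _ => Finset.range (P + 1)
  let B : Finset (Fin n → ℕ) := Fintype.piFinset fun j => Finset.range (N j)
  let g : (Fin m → ℕ) → (Fin n → ℕ) := fun q j => ⌊(N j : ℝ) * Int.fract (Lq q j)⌋₊
  have hmaps : ∀ q ∈ S, g q ∈ B := by
    intro q _
    simp only [B, Fintype.mem_piFinset, Finset.mem_range]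
    intro j
    have hNp : (0 : ℝ) < N j := by exact_mod_cast hNpos j
    refine (Nat.floor_lt (mul_nonneg hNp.le (Int.fract_nonneg _))).2 ?_
    nlinarith [Int.fract_lt_one (Lq q j)]
  have hBne : B.Nonempty := by
    refine ⟨fun _ => 0, ?_⟩
    simp only [B, Fintype.mem_piFinset, Finset.mem_range]
    exact hNpos
  have hScard : (S.card : ℝ) = ((P : ℝ) + 1) ^ m := by simp [S]
  have hBcard : (B.card : ℝ) = ∏ j, (N j : ℝ) := by simp [B]
  have hcard : B.card • ((T : ℝ) ^ (m + n) / 2 ^ n) ≤ (S.card : ℝ) := by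
    rw [nsmul_eq_mul, hScard, hBcard]
    have h1 : ∏ j, (N j : ℝ) ≤ ∏ j, (2 * D j / T) :=
      Finset.prod_le_prod (fun j _ => Nat.cast_nonneg _) (fun j _ => hNle j)
    have h2 : ∏ j, (2 * D j / T) = 2 ^ n * Q ^ m / T ^ n := by
      rw [Finset.prod_div_distrib, Finset.prod_mul_distrib, hprod]
      simp
    rw [h2] at h1
    calc (∏ j, (N j : ℝ)) * ((T : ℝ) ^ (m + n) / 2 ^ n)
        ≤ (2 ^ n * Q ^ m / T ^ n) * ((T : ℝ) ^ (m + n) / 2 ^ n) :=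
          mul_le_mul_of_nonneg_right h1 (by positivity)
      _ = (T * Q) ^ m := by rw [pow_add, mul_pow]; field_simp
      _ ≤ _ := pow_le_pow_left₀ (by positivity) (Nat.lt_floor_add_one _).le _
  obtain ⟨y, _, hy⟩ := Finset.exists_le_card_fiber_of_nsmul_le_card_of_maps_to hmaps hBne hcard
  set F0 := S.filter fun q => g q = y with hF0
  have hF0ne : F0.Nonempty := by
    rw [← Finset.card_pos]
    have : (0 : ℝ) < F0.card := lt_of_lt_of_le (by positivity) hy
    exact_mod_cast this
  obtain ⟨q0, hq0⟩ := hF0ne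
  let h : (Fin m → ℕ) → (Fin m ⊕ Fin n → ℤ) := fun q =>
    Sum.elim (fun i => (q i : ℤ) - q0 i) (fun j => ⌊Lq q j⌋ - ⌊Lq q0 j⌋)
  have hinj : Function.Injective h := by
    intro q q' hqq
    funext i
    have := congrFun hqq (Sum.inl i)
    simp only [h, Sum.elim_inl] at this
    omega
  refine ⟨F0.image h, ?_, ?_⟩
  · rw [Finset.card_image_of_injective _ hinj]; exact hy
  · intro z hz a
    obtain ⟨q, hq, rfl⟩ := Finset.mem_image.1 hz
    simp only [hF0, S, Finset.mem_filter, Fintype.mem_piFinset, Finset.mem_range] at hq hq0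
    rcases a with i | j
    · simp only [sc, h, Sum.elim_inl]
      have hfl : (P : ℝ) ≤ T * Q := Nat.floor_le (by positivity)
      have h1 : (q i : ℝ) ≤ P := by exact_mod_cast Nat.lt_succ_iff.1 (hq.1 i)
      have h2 : (q0 i : ℝ) ≤ P := by exact_mod_cast Nat.lt_succ_iff.1 (hq0.1 i)
      have h3 : (0 : ℝ) ≤ q i := Nat.cast_nonneg _
      have h4 : (0 : ℝ) ≤ q0 i := Nat.cast_nonneg _
      rw [abs_mul, abs_of_pos (inv_pos.2 hQ), inv_mul_le_iff₀ hQ, abs_le]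
      push_cast
      constructor <;> linarith
    · simp only [sc, h, Sum.elim_inl, Sum.elim_inr]
      have h1 : (∑ i, (((q i : ℤ) - q0 i : ℤ) : ℝ) * L j i) - ((⌊Lq q j⌋ - ⌊Lq q0 j⌋ : ℤ) : ℝ)
          = Int.fract (Lq q j) - Int.fract (Lq q0 j) := by
        simp only [Int.fract, Lq]
        push_cast
        simp only [sub_mul, Finset.sum_sub_distrib]
        ring
      rw [h1]
      have h2 : g q j = g q0 j := by rw [hq.2, hq0.2]
      simp only [g] at h2
      have hNp : (0 : ℝ) < N j := by exact_mod_cast hNpos j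
      have a1 := Nat.floor_le (mul_nonneg hNp.le (Int.fract_nonneg (Lq q j)))
      have a2 := Nat.lt_floor_add_one ((N j : ℝ) * Int.fract (Lq q j))
      have a3 := Nat.floor_le (mul_nonneg hNp.le (Int.fract_nonneg (Lq q0 j)))
      have a4 := Nat.lt_floor_add_one ((N j : ℝ) * Int.fract (Lq q0 j))
      rw [h2] at a1 a2
      have h3 : |(N j : ℝ) * (Int.fract (Lq q j) - Int.fract (Lq q0 j))| ≤ 1 := by
        rw [mul_sub, abs_le]; constructor <;> linarith
      rw [abs_mul, abs_of_pos hNp] at h3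
      rw [abs_mul, abs_of_pos (hD0 j)]
      have h4 := hNge j
      rw [div_le_iff₀ hT0] at h4
      calc _ ≤ ((N j : ℝ) * T) * |Int.fract (Lq q j) - Int.fract (Lq q0 j)| :=
            mul_le_mul_of_nonneg_right h4 (abs_nonneg _)
        _ = T * (N j * |Int.fract (Lq q j) - Int.fract (Lq q0 j)|) := by ring
        _ ≤ T * 1 := mul_le_mul_of_nonneg_left h3 hT0.le
        _ = T := mul_one _

lemma no_hyperplane {n m : ℕ} (hn : 0 < n) (L : Matrix (Fin n) (Fin m) ℝ) (Q : ℝ) (D : Fin n → ℝ)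
    (hQ : 0 < Q) (hprod : ∏ j, D j = Q ^ m) (T : ℕ) (hT : 1 ≤ T) (hD : ∀ j, (T : ℝ) ≤ D j)
    (e : ℝ) (he : 0 < e)
    (hbad : ∀ z : Fin m ⊕ Fin n → ℤ, (∀ a, |sc L Q D z a| < e) → z = 0)
    (hTbig : 2 ^ n * (2 * (m + n) / e + 3) ^ (m + n - 1) < (T : ℝ))
    (f : Fin m ⊕ Fin n → ℝ)
    (hf : ∀ z : Fin m ⊕ Fin n → ℤ, (∀ a, |sc L Q D z a| ≤ T) → ∑ a, f a * sc L Q D z a = 0) :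
    f = 0 := by
  classical
  by_contra hf0
  have hne : Nonempty (Fin m ⊕ Fin n) := ⟨Sum.inr ⟨0, hn⟩⟩
  obtain ⟨s, hs⟩ := Finite.exists_max (fun a => |f a|)
  have hfs : 0 < |f s| := by
    obtain ⟨a, ha⟩ := Function.ne_iff.1 hf0
    exact lt_of_lt_of_le (abs_pos.2 ha) (hs a)
  obtain ⟨F, hFcard, hF⟩ := many_points L Q D hQ hprod T hT hD
  have hT0 : (0 : ℝ) < T := by exact_mod_cast hT
  have hT1 : (1 : ℝ) ≤ T := by exact_mod_cast hT
  set R : ℝ := (m + n : ℝ) with hR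
  have hR1 : 1 ≤ R := by
    have : (1 : ℝ) ≤ n := by exact_mod_cast hn
    have : (0 : ℝ) ≤ m := Nat.cast_nonneg _
    linarith
  set M := ⌈(T : ℝ) * R / e⌉₊ with hM
  let g : (Fin m ⊕ Fin n → ℤ) → ({a : Fin m ⊕ Fin n // a ≠ s} → ℤ) := fun z a =>
    ⌊sc L Q D z a * (R / e)⌋
  let B : Finset ({a : Fin m ⊕ Fin n // a ≠ s} → ℤ) :=
    Fintype.piFinset fun _ => Finset.Icc (-(M : ℤ)) M
  have hRe : 0 < R / e := by positivity
  have hMge : (T : ℝ) * R / e ≤ M := Nat.le_ceil _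
  have hmaps : ∀ z ∈ F, g z ∈ B := by
    intro z hz
    simp only [B, g, Fintype.mem_piFinset, Finset.mem_Icc]
    intro a
    have h1 := abs_le.1 (hF z hz a)
    have h2 : (T : ℝ) * R / e = T * (R / e) := by ring
    rw [h2] at hMge
    constructor
    · rw [Int.le_floor]
      push_cast
      nlinarith
    · have : (⌊sc L Q D z a * (R / e)⌋ : ℝ) ≤ M := by
        refine (Int.floor_le _).trans ?_
        nlinarith
      exact_mod_cast this
  have hinj : Set.InjOn g F := by
    intro z hz z' hz' hzz
    have hother : ∀ a, a ≠ s → |sc L Q D (z - z') a| ≤ e / R := by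
      intro a ha
      have h1 := congrFun hzz ⟨a, ha⟩
      simp only [g] at h1
      have h2 := Int.abs_sub_lt_one_of_floor_eq_floor h1
      rw [← sub_mul, abs_mul, abs_of_pos hRe] at h2
      rw [sc_sub, Pi.sub_apply, le_div_iff₀ (by linarith)]
      rw [← mul_div_assoc, div_lt_one he] at h2
      exact h2.le
    have hsum : ∑ a, f a * sc L Q D (z - z') a = 0 := by
      rw [sc_sub]
      simp only [Pi.sub_apply, mul_sub, Finset.sum_sub_distrib]
      rw [hf z (hF z hz), hf z' (hF z' hz'), sub_zero]
    have hlast : |sc L Q D (z - z') s| ≤ (R - 1) * (e / R) := by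
      rw [← Finset.add_sum_erase _ _ (Finset.mem_univ s)] at hsum
      have h1 : f s * sc L Q D (z - z') s
          = -∑ a ∈ Finset.univ.erase s, f a * sc L Q D (z - z') a := by linarith
      have h2 : |f s| * |sc L Q D (z - z') s| ≤ |f s| * ((R - 1) * (e / R)) := by
        rw [← abs_mul, h1, abs_neg]
        refine (Finset.abs_sum_le_sum_abs _ _).trans ?_
        have : |f s| * ((R - 1) * (e / R)) = ∑ a ∈ Finset.univ.erase s, |f s| * (e / R) := by
          rw [Finset.sum_const, Finset.card_erase_of_mem (Finset.mem_univ s), Finset.card_univ,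
            Fintype.card_sum, Fintype.card_fin, Fintype.card_fin, nsmul_eq_mul,
            Nat.cast_sub (by omega), hR]
          push_cast
          ring
        rw [this]
        refine Finset.sum_le_sum fun a ha => ?_
        rw [abs_mul]
        exact mul_le_mul (hs a) (hother a (Finset.ne_of_mem_erase ha)) (abs_nonneg _)
          (abs_nonneg _)
      exact le_of_mul_le_mul_left h2 hfs
    have hz0 := hbad (z - z') (fun a => by
      by_cases ha : a = s
      · subst ha
        refine hlast.trans_lt ?_
        have : 0 < e / R := by positivity
        have h3 : R * (e / R) = e := by field_simp
        nlinarith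
      · by_cases hR2 : R = 1
        · exfalso
          have h5 : m + n = 1 := by
            have : ((m + n : ℕ) : ℝ) = 1 := by push_cast; exact hR2
            exact_mod_cast this
          have h6 : Fintype.card (Fin m ⊕ Fin n) = 1 := by simpa using h5
          exact ha ((Fintype.card_le_one_iff.1 h6.le) a s)
        · refine (hother a ha).trans_lt ?_
          have : 1 < R := lt_of_le_of_ne hR1 (Ne.symm hR2)
          rw [div_lt_iff₀ (by linarith)]
          nlinarith)
    exact sub_eq_zero.1 hz0
  have hcard := Finset.card_le_card_of_injOn g hmaps hinj
  have hBcard : B.card = (2 * M + 1) ^ (m + n - 1) := by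
    simp only [B, Fintype.card_piFinset, Int.card_Icc, Finset.prod_const, Finset.card_univ,
      Fintype.card_subtype_compl, Fintype.card_sum, Fintype.card_fin]
    congr 1
    · omega
  have hMle : (2 * M + 1 : ℝ) ≤ T * (2 * R / e + 3) := by
    have h1 : (M : ℝ) ≤ T * R / e + 1 := (Nat.ceil_lt_add_one (by positivity)).le
    have h2 : (T : ℝ) * (2 * R / e + 3) = 2 * (T * R / e) + 3 * T := by ring
    rw [h2]; linarith
  have hfin : (T : ℝ) ^ (m + n) / 2 ^ n ≤ (T * (2 * R / e + 3)) ^ (m + n - 1) := by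
    refine hFcard.trans ?_
    calc (F.card : ℝ) ≤ B.card := by exact_mod_cast hcard
      _ = (2 * M + 1 : ℝ) ^ (m + n - 1) := by rw [hBcard]; push_cast; rfl
      _ ≤ _ := pow_le_pow_left₀ (by positivity) hMle _
  have h7 : (T : ℝ) ^ (m + n) = T ^ (m + n - 1) * T := by
    rw [← pow_succ]; congr 1; omega
  rw [div_le_iff₀ (by positivity), h7, mul_pow, mul_assoc] at hfin
  have := le_of_mul_le_mul_left hfin (by positivity)
  linarith

lemma dual_of_span {n m : ℕ} (L : Matrix (Fin n) (Fin m) ℝ) (Q : ℝ) (D : Fin n → ℝ)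
    (hQ : 0 < Q) (hprod : ∏ j, D j = Q ^ m) (hD0 : ∀ j, 0 < D j) (T : ℝ) (hT : 1 ≤ T)
    (hspan : ∀ f : Fin m ⊕ Fin n → ℝ,
      (∀ z : Fin m ⊕ Fin n → ℤ, (∀ a, |sc L Q D z a| ≤ T) → ∑ a, f a * sc L Q D z a = 0) → f = 0)
    (s : Fin n) :
    ∃ (u : Fin n → ℤ) (v : Fin m → ℤ),
      (∀ j, |(u j : ℝ)| ≤ ((m + n).factorial * T ^ (m + n)) * D j) ∧
      (∀ i, |(v i : ℝ) + ∑ j, (u j : ℝ) * L j i| ≤ ((m + n).factorial * T ^ (m + n)) / Q) ∧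
      1 / ((m + n) * T) * D s ≤ |(u s : ℝ)| := by
  classical
  let W : Set (Fin m ⊕ Fin n → ℝ) := sc L Q D '' {z | ∀ a, |sc L Q D z a| ≤ T}
  have htop : Submodule.span ℝ W = ⊤ := by
    by_contra hne
    obtain ⟨f, hf0, hf⟩ := Submodule.exists_le_ker_of_lt_top _ (lt_top_iff_ne_top.2 hne)
    apply hf0
    have h1 := hspan (fun a => f (Pi.single a 1)) (fun z hz => by
      have h2 : f (sc L Q D z) = 0 := hf (Submodule.subset_span ⟨z, hz, rfl⟩)
      rw [LinearMap.pi_apply_eq_sum_univ f] at h2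
      simp only [smul_eq_mul] at h2
      rw [← h2]
      refine Finset.sum_congr rfl fun a _ => ?_
      rw [mul_comm]
      congr 2
      funext b
      simp [Pi.single_apply, eq_comm])
    refine LinearMap.pi_ext' fun a => ?_
    ext
    simpa using congrFun h1 a
  obtain ⟨b, hbW, hbspan, hbli⟩ := exists_linearIndependent ℝ W
  rw [htop] at hbspan
  let bas := Module.Basis.mk hbli (by rw [Subtype.range_coe]; exact hbspan.ge)
  let e : (Fin m ⊕ Fin n) ≃ b := (Pi.basisFun ℝ (Fin m ⊕ Fin n)).indexEquiv bas
  have hz : ∀ l, ∃ z : Fin m ⊕ Fin n → ℤ, (∀ a, |sc L Q D z a| ≤ T) ∧ sc L Q D z = (e l).1 := by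
    intro l
    obtain ⟨z, hz1, hz2⟩ := hbW (e l).2
    exact ⟨z, hz1, hz2⟩
  choose z hzT hze using hz
  let S : Matrix (Fin m ⊕ Fin n) (Fin m ⊕ Fin n) ℝ := Matrix.of fun l => sc L Q D (z l)
  have hSdet : S.det ≠ 0 := by
    have h1 : LinearIndependent ℝ S.row := by
      have : S.row = (Subtype.val : b → (Fin m ⊕ Fin n → ℝ)) ∘ e := by
        funext l; exact hze l
      rw [this]
      exact hbli.comp e e.injective
    have := Matrix.linearIndependent_rows_iff_isUnit.1 h1
    exact ((Matrix.isUnit_iff_isUnit_det _).1 this).ne_zero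
  let M : Matrix (Fin m ⊕ Fin n) (Fin m ⊕ Fin n) ℤ := Matrix.of z
  let MR : Matrix (Fin m ⊕ Fin n) (Fin m ⊕ Fin n) ℝ := M.map (Int.castRingHom ℝ)
  let A : Matrix (Fin m ⊕ Fin n) (Fin m ⊕ Fin n) ℝ := Matrix.fromBlocks 1 L.transpose 0 (-1)
  let Dd : Fin m ⊕ Fin n → ℝ := Sum.elim (fun _ => Q⁻¹) D
  let Δ : Matrix (Fin m ⊕ Fin n) (Fin m ⊕ Fin n) ℝ := Matrix.diagonal Dd
  have hS : S = MR * A * Δ := by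
    ext l a
    rw [Matrix.mul_diagonal, Matrix.mul_apply, Fintype.sum_sum_type]
    rcases a with i | j
    · simp [S, A, MR, M, Dd, sc, Matrix.one_apply, mul_comm]
    · simp [S, A, MR, M, Dd, sc, Matrix.one_apply, mul_comm, sub_eq_add_neg]
  have hΔdet : Δ.det = 1 := by
    simp only [Δ, Dd, Matrix.det_diagonal, Fintype.prod_sum_type, Sum.elim_inl, Sum.elim_inr, hprod]
    simp [hQ.ne']
  have hAdet : A.det = (-1) ^ n := by
    simp [A, Matrix.det_neg]
  have hAA : A * A = 1 := by
    simp [A, Matrix.fromBlocks_multiply, Matrix.fromBlocks_one]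
  have hMRdet : MR.det = (M.det : ℝ) := by
    simp only [MR]
    exact (RingHom.map_det (Int.castRingHom ℝ) M).symm
  have hSdet1 : 1 ≤ |S.det| := by
    have h1 : |S.det| = |(M.det : ℝ)| := by
      rw [hS, Matrix.det_mul, Matrix.det_mul, hΔdet, hAdet, hMRdet, mul_one, abs_mul, abs_pow]
      simp
    rw [h1]
    have h2 : M.det ≠ 0 := by
      intro h0
      apply hSdet
      rw [← abs_eq_zero, h1, h0]; simp
    exact_mod_cast Int.one_le_abs h2
  have hST : ∀ l a, |S l a| ≤ T := fun l a => hzT l a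
  have hadj : ∀ a l, |S.adjugate a l| ≤ (m + n).factorial * T ^ (m + n) := by
    intro a l
    rw [Matrix.adjugate_apply]
    have := Matrix.det_le (A := S.updateRow l (Pi.single a 1)) (abv := AbsoluteValue.abs) (x := T)
      (by
        intro i j
        simp only [AbsoluteValue.abs_apply, Matrix.updateRow_apply]
        split_ifs with h
        · by_cases hj : j = a
          · subst hj; simpa using hT
          · simp [hj]; linarith
        · exact hST i j)
    simpa using this
  have hrel : Δ * S.adjugate = (A.det • A) * MR.adjugate := by
    have h1 : A.adjugate = A.det • A := by
      calc A.adjugate = A.adjugate * (A * A) := by rw [hAA, mul_one]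
        _ = (A.adjugate * A) * A := by rw [mul_assoc]
        _ = _ := by rw [Matrix.adjugate_mul]; simp
    rw [hS, Matrix.adjugate_mul_distrib, ← mul_assoc, Matrix.mul_adjugate, hΔdet, one_smul, one_mul,
      Matrix.adjugate_mul_distrib, h1]
  have hMRadj : MR.adjugate = M.adjugate.map (Int.castRingHom ℝ) :=
    (RingHom.map_adjugate (Int.castRingHom ℝ) M).symm
  have hent : ∀ a l, Dd a * |S.adjugate a l| = |(A * MR.adjugate) a l| := by
    intro a l
    have h1 := congrFun (congrFun hrel a) l
    simp only [Δ] at h1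
    rw [Matrix.diagonal_mul, Matrix.smul_mul, Matrix.smul_apply, hAdet, smul_eq_mul] at h1
    have h2 := congrArg abs h1
    rw [abs_mul, abs_mul, abs_pow] at h2
    have h3 : 0 < Dd a := by
      rcases a with i | j
      · exact inv_pos.2 hQ
      · exact hD0 j
    rw [abs_of_pos h3] at h2
    simpa using h2
  -- pick the column
  have hcol : ∃ l, 1 / ((m + n) * T) ≤ |S.adjugate (Sum.inr s) l| := by
    by_contra hcon
    push Not at hcon
    have h1 := congrFun (congrFun (Matrix.adjugate_mul S) (Sum.inr s)) (Sum.inr s)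
    rw [Matrix.mul_apply, Matrix.smul_apply, Matrix.one_apply_eq, smul_eq_mul, mul_one] at h1
    rw [← h1] at hSdet1
    have h2 : |∑ l, S.adjugate (Sum.inr s) l * S l (Sum.inr s)|
        < ∑ l : Fin m ⊕ Fin n, 1 / ((m + n) * T) * T := by
      refine (Finset.abs_sum_le_sum_abs _ _).trans_lt ?_
      refine Finset.sum_lt_sum_of_nonempty ⟨Sum.inr s, Finset.mem_univ _⟩ fun l _ => ?_
      rw [abs_mul]
      calc _ ≤ |S.adjugate (Sum.inr s) l| * T :=
            mul_le_mul_of_nonneg_left (hST _ _) (abs_nonneg _)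
        _ < _ := mul_lt_mul_of_pos_right (hcon l) (by linarith)
    have hpos : (0 : ℝ) < m + n := by
      have : 0 < n := Fin.pos s
      have h3 : (0 : ℝ) < n := by exact_mod_cast this
      positivity
    have h4 : ∑ l : Fin m ⊕ Fin n, 1 / ((m + n) * T) * T = (1 : ℝ) := by
      rw [Finset.sum_const, Finset.card_univ, Fintype.card_sum, Fintype.card_fin, Fintype.card_fin,
        nsmul_eq_mul]
      push_cast
      have : T ≠ 0 := by linarith
      field_simp
    linarith
  obtain ⟨l, hl⟩ := hcol
  have hu : ∀ j, |(M.adjugate (Sum.inr j) l : ℝ)| = D j * |S.adjugate (Sum.inr j) l| := by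
    intro j
    have := hent (Sum.inr j) l
    simp only [Dd, Sum.elim_inr] at this
    rw [this, hMRadj, Matrix.mul_apply, Fintype.sum_sum_type]
    simp [A, Matrix.one_apply]
  have hv : ∀ i, |(M.adjugate (Sum.inl i) l : ℝ) + ∑ j, (M.adjugate (Sum.inr j) l : ℝ) * L j i|
      = Q⁻¹ * |S.adjugate (Sum.inl i) l| := by
    intro i
    have := hent (Sum.inl i) l
    simp only [Dd, Sum.elim_inl] at this
    rw [this, hMRadj, Matrix.mul_apply, Fintype.sum_sum_type]
    simp [A, Matrix.one_apply, mul_comm]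
  refine ⟨fun j => M.adjugate (Sum.inr j) l, fun i => M.adjugate (Sum.inl i) l, ?_, ?_, ?_⟩
  · intro j
    rw [hu, mul_comm]
    exact mul_le_mul_of_nonneg_right (hadj _ _) (hD0 j).le
  · intro i
    rw [hv, mul_comm, ← div_eq_mul_inv]
    exact div_le_div_of_nonneg_right (hadj _ _) hQ.le
  · rw [hu, mul_comm]
    exact mul_le_mul_of_nonneg_left hl (hD0 s).le

lemma cell_count (n : ℕ) (hn : 0 < n) (b K : ℕ) (hb : 2 ≤ b)
    (hK : K + (n + 1) * b ^ (n - 1) ≤ b ^ n) (u x : Fin n → ℝ) (σ w : ℝ) (hσ : 0 < σ)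
    (hw : w * (2 * b) = σ) (hu : (∑ j, |u j|) * σ ≤ 1 / 2) :
    ∃ ι : Fin K → (Fin n → Fin b), Function.Injective ι ∧ ∀ d, ∀ α : Fin n → ℝ,
      (∀ j, x j + w * (2 * (ι d j : ℕ)) ≤ α j ∧ α j ≤ x j + w * (2 * (ι d j : ℕ)) + w) →
      ∀ (p : ℤ) j, |u j| * w ≤ |∑ j, u j * α j - p| := by
  classical
  have hb' : (2 : ℝ) ≤ b := by exact_mod_cast hb
  have hwp : 0 < w := by
    by_contra h
    push Not at h
    nlinarith
  have : Nonempty (Fin n) := ⟨⟨0, hn⟩⟩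
  obtain ⟨s, hs⟩ := Finite.exists_max (fun j => |u j|)
  let cell : (Fin n → Fin b) → (Fin n → ℝ) → Prop := fun i α =>
    ∀ j, x j + w * (2 * (i j : ℕ)) ≤ α j ∧ α j ≤ x j + w * (2 * (i j : ℕ)) + w
  let S : Finset (Fin n → Fin b) := Finset.univ.filter fun i =>
    ∃ α, cell i α ∧ ∃ p : ℤ, |∑ j, u j * α j - p| < |u s| * w
  have hS : S.card ≤ (n + 1) * b ^ (n - 1) := by
    let f : (Fin n → Fin b) → (({j : Fin n // j ≠ s} → Fin b) × Fin (n + 1)) := fun i =>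
      (fun j => i j, Fin.ofNat (n + 1) (i s))
    have hinj : Set.InjOn f S := by
      intro i hi i' hi' hff
      simp only [S, Finset.coe_filter, Finset.mem_univ, true_and, Set.mem_ofPred_eq] at hi hi'
      obtain ⟨α, hα, p, hp⟩ := hi
      obtain ⟨α', hα', p', hp'⟩ := hi'
      simp only [f, Prod.mk.injEq] at hff
      obtain ⟨h1, h2⟩ := hff
      have h1' : ∀ j, j ≠ s → i j = i' j := fun j hj => congrFun h1 ⟨j, hj⟩
      have h2' : (i s : ℕ) % (n + 1) = (i' s : ℕ) % (n + 1) := by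
        have := congrArg Fin.val h2
        simpa [Fin.ofNat] using this
      -- all in big cube
      have hcube : ∀ (i : Fin n → Fin b) α, cell i α → ∀ j, x j ≤ α j ∧ α j ≤ x j + σ := by
        intro i α h j
        have hi : ((i j : ℕ) : ℝ) + 1 ≤ b := by exact_mod_cast (i j).2
        have h0 : (0 : ℝ) ≤ ((i j : ℕ) : ℝ) := Nat.cast_nonneg _
        constructor
        · have := (h j).1
          nlinarith [mul_nonneg hwp.le h0]
        · have := (h j).2
          rw [← hw]
          nlinarith
      have hD : |∑ j, u j * α j - ∑ j, u j * α' j| ≤ 1 / 2 := by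
        rw [← Finset.sum_sub_distrib]
        refine (Finset.abs_sum_le_sum_abs _ _).trans (le_trans ?_ hu)
        rw [Finset.sum_mul]
        refine Finset.sum_le_sum fun j _ => ?_
        rw [← mul_sub, abs_mul]
        refine mul_le_mul_of_nonneg_left ?_ (abs_nonneg _)
        have a1 := hcube i α hα j
        have a2 := hcube i' α' hα' j
        rw [abs_le]; constructor <;> linarith
      have hus : |u s| * w ≤ 1 / 8 := by
        have : |u s| ≤ ∑ j, |u j| :=
          Finset.single_le_sum (f := fun j => |u j|) (fun j _ => abs_nonneg _) (Finset.mem_univ s)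
        have h3 : |u s| * σ ≤ 1 / 2 := le_trans (mul_le_mul_of_nonneg_right this hσ.le) hu
        rw [← hw] at h3
        nlinarith [mul_nonneg (abs_nonneg (u s)) hwp.le]
      have hpp : p = p' := by
        have : |((p - p' : ℤ) : ℝ)| < 1 := by
          push_cast
          rw [abs_lt]
          rw [abs_le] at hD
          rw [abs_lt] at hp hp'
          constructor <;> linarith
        have h4 : |p - p'| < 1 := by exact_mod_cast this
        have := Int.abs_lt_one_iff.1 h4
        omega
      subst hpp
      have hD2 : |∑ j, u j * (α j - α' j)| < 2 * (|u s| * w) := by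
        simp only [mul_sub, Finset.sum_sub_distrib]
        rw [abs_lt] at hp hp' ⊢
        constructor <;> linarith
      have hrest : |∑ j ∈ Finset.univ.erase s, u j * (α j - α' j)| ≤ (n - 1) * (|u s| * w) := by
        refine (Finset.abs_sum_le_sum_abs _ _).trans ?_
        have : ((n : ℝ) - 1) * (|u s| * w) = ∑ j ∈ Finset.univ.erase s, |u s| * w := by
          rw [Finset.sum_const, Finset.card_erase_of_mem (Finset.mem_univ s)]
          simp [Nat.cast_sub (Nat.succ_le_of_lt hn)]
        rw [this]
        refine Finset.sum_le_sum fun j hj => ?_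
        rw [abs_mul]
        refine mul_le_mul (hs j) ?_ (abs_nonneg _) (abs_nonneg _)
        have a1 := hα j
        have a2 := hα' j
        rw [h1' j (Finset.ne_of_mem_erase hj)] at a1
        rw [abs_le]; constructor <;> linarith
      rw [← Finset.add_sum_erase _ _ (Finset.mem_univ s)] at hD2
      have h5 : |u s| * |α s - α' s| < |u s| * ((n + 1) * w) := by
        rw [← abs_mul]
        have := abs_sub_abs_le_abs_sub (u s * (α s - α' s))
          (-(∑ j ∈ Finset.univ.erase s, u j * (α j - α' j)))
        rw [abs_neg, sub_neg_eq_add] at this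
        linarith
      have h6 : |α s - α' s| < (n + 1) * w := lt_of_mul_lt_mul_left h5 (abs_nonneg _)
      have a1 := hα s
      have a2 := hα' s
      rw [abs_lt] at h6
      have h7 : (2 * (i s : ℕ) : ℝ) < 2 * (i' s : ℕ) + (n + 2) := by
        have : w * (2 * (i s : ℕ)) < w * (2 * (i' s : ℕ) + (n + 2)) := by linarith
        exact lt_of_mul_lt_mul_left this hwp.le
      have h8 : (2 * (i' s : ℕ) : ℝ) < 2 * (i s : ℕ) + (n + 2) := by
        have : w * (2 * (i' s : ℕ)) < w * (2 * (i s : ℕ) + (n + 2)) := by linarith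
        exact lt_of_mul_lt_mul_left this hwp.le
      have h7' : 2 * (i s : ℕ) < 2 * (i' s : ℕ) + (n + 2) := by exact_mod_cast h7
      have h8' : 2 * (i' s : ℕ) < 2 * (i s : ℕ) + (n + 2) := by exact_mod_cast h8
      have h9 : (i s : ℕ) = i' s := by
        rcases le_total (i s : ℕ) (i' s) with h | h
        · have := (Nat.modEq_iff_dvd' h).1 h2'
          have := Nat.eq_zero_of_dvd_of_lt this (by omega)
          omega
        · have := (Nat.modEq_iff_dvd' h).1 h2'.symm
          have := Nat.eq_zero_of_dvd_of_lt this (by omega)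
          omega
      funext j
      by_cases hj : j = s
      · subst hj; exact Fin.ext h9
      · exact h1' j hj
    have := Finset.card_le_card_of_injOn (t := Finset.univ) f (fun _ _ => Finset.mem_univ _) hinj
    refine this.trans ?_
    simp [Finset.card_univ, Fintype.card_subtype_compl, mul_comm]
  have hc : Fintype.card (Fin K) ≤ Fintype.card {i // i ∈ Sᶜ} := by
    have : Sᶜ.card = b ^ n - S.card := by
      rw [Finset.card_compl]; simp
    rw [Fintype.card_fin, Fintype.card_coe, this]
    omega
  obtain ⟨e⟩ := Function.Embedding.nonempty_of_card_le hc
  refine ⟨fun d => (e d : Fin n → Fin b), fun d d' h => e.injective (Subtype.ext h), ?_⟩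
  intro d α hα p j
  have he := (e d).2
  simp only [S, Finset.mem_compl, Finset.mem_filter, Finset.mem_univ, true_and] at he
  push Not at he
  exact (mul_le_mul_of_nonneg_right (hs j) hwp.le).trans (he α hα p)

/-- Corners of the Cantor construction. -/
noncomputable def corner {n b K : ℕ} (ι : ℕ → (Fin n → ℝ) → Fin K → Fin n → Fin b)
    (d : ℕ → Fin K) : ℕ → (Fin n → ℝ)
  | 0 => 0
  | l + 1 => fun j => corner ι d l j +
      (((2 * b : ℝ)) ^ (l + 1))⁻¹ * (2 * (ι l (corner ι d l) (d l) j : ℕ))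

lemma corner_congr {n b K : ℕ} (ι : ℕ → (Fin n → ℝ) → Fin K → Fin n → Fin b)
    (d d' : ℕ → Fin K) (l : ℕ) (h : ∀ i < l, d i = d' i) : corner ι d l = corner ι d' l := by
  induction l with
  | zero => rfl
  | succ l ih =>
    have := ih (fun i hi => h i (by omega))
    funext j
    simp only [corner]
    rw [this, h l (by omega)]

lemma dimH_of_param {A X : Type*} [EMetricSpace X] (r : NNReal) (hr : 0 < r) (C : NNReal)
    (φ : A → X) (ψ : A → ℝ) (hψ : Set.Ico (0 : ℝ) 1 ⊆ Set.range ψ)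
    (h : ∀ a a', edist (ψ a) (ψ a') ≤ C * edist (φ a) (φ a') ^ (r : ℝ)) :
    (r : ENNReal) ≤ dimH (Set.range φ) := by
  classical
  have hinv : ∀ x ∈ Set.range φ, ∃ a, φ a = x := fun x hx => hx
  obtain ⟨a0, _⟩ := hψ (show (0 : ℝ) ∈ Set.Ico (0 : ℝ) 1 by simp)
  have : Nonempty A := ⟨a0⟩
  let g : X → ℝ := fun x => ψ (Function.invFun φ x)
  have hg : HolderOnWith C r g (Set.range φ) := by
    rintro _ ⟨a, rfl⟩ _ ⟨a', rfl⟩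
    have h1 : φ (Function.invFun φ (φ a)) = φ a := Function.invFun_eq ⟨a, rfl⟩
    have h2 : φ (Function.invFun φ (φ a')) = φ a' := Function.invFun_eq ⟨a', rfl⟩
    have := h (Function.invFun φ (φ a)) (Function.invFun φ (φ a'))
    rwa [h1, h2] at this
  have himg : Set.Ico (0 : ℝ) 1 ⊆ g '' Set.range φ := by
    intro y hy
    obtain ⟨a, rfl⟩ := hψ hy
    refine ⟨φ a, ⟨a, rfl⟩, ?_⟩
    have h1 : φ (Function.invFun φ (φ a)) = φ a := Function.invFun_eq ⟨a, rfl⟩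
    have := h (Function.invFun φ (φ a)) a
    rw [h1, edist_self, ENNReal.zero_rpow_of_pos (by exact_mod_cast hr), mul_zero] at this
    exact edist_eq_zero.1 (le_antisymm this bot_le)
  have h1 : dimH (Set.Ico (0 : ℝ) 1) = 1 := by
    have := Real.dimH_of_nonempty_interior (E := ℝ) (s := Set.Ico (0 : ℝ) 1)
      (by rw [interior_Ico]; exact ⟨1/2, by norm_num⟩)
    simpa using this
  have := (dimH_mono himg).trans (hg.dimH_image_le hr)
  rw [h1] at this
  rw [ENNReal.le_div_iff_mul_le (Or.inl (by exact_mod_cast hr.ne')) (Or.inl ENNReal.coe_ne_top),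
    one_mul] at this
  exact this

theorem cantor_dim (n : ℕ) (hn : 0 < n) (b K : ℕ) (hb : 2 ≤ b) (hK2 : 2 ≤ K)
    (hK : K + (n + 1) * b ^ (n - 1) ≤ b ^ n) (r : NNReal) (hr0 : 0 < r)
    (hr : (2 * b : ℝ) ^ (r : ℝ) = K) (u : ℕ → Fin n → ℝ)
    (hu : ∀ l, (∑ j, |u l j|) ≤ (2 * b : ℝ) ^ l / 2) :
    (r : ENNReal) ≤ dimH {α : Fin n → ℝ | (∀ j, α j ∈ Set.Ico (0 : ℝ) 1) ∧
      ∀ l (p : ℤ) j, |u l j| * ((2 * b : ℝ) ^ (l + 1))⁻¹ ≤ |∑ j, u l j * α j - p|} := by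
  have hb' : (2 : ℝ) ≤ b := by exact_mod_cast hb
  have hβ : (0 : ℝ) < 2 * b := by linarith
  have key : ∀ (l : ℕ) (x : Fin n → ℝ), ∃ ι : Fin K → (Fin n → Fin b), Function.Injective ι ∧
      ∀ d, ∀ α : Fin n → ℝ, (∀ j, x j + ((2 * b : ℝ) ^ (l + 1))⁻¹ * (2 * (ι d j : ℕ)) ≤ α j ∧
        α j ≤ x j + ((2 * b : ℝ) ^ (l + 1))⁻¹ * (2 * (ι d j : ℕ)) + ((2 * b : ℝ) ^ (l + 1))⁻¹) →
      ∀ (p : ℤ) j, |u l j| * ((2 * b : ℝ) ^ (l + 1))⁻¹ ≤ |∑ j, u l j * α j - p| := by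
    intro l x
    refine cell_count n hn b K hb hK (u l) x ((2 * b : ℝ) ^ l)⁻¹ _ (by positivity) ?_ ?_
    · rw [pow_succ]; field_simp
    · rw [← div_eq_mul_inv, div_le_iff₀ (by positivity)]
      linarith [hu l]
  choose ι hinj hι using key
  set w : ℕ → ℝ := fun l => ((2 * b : ℝ) ^ l)⁻¹ with hw
  have hwpos : ∀ l, 0 < w l := fun l => by simp only [hw]; positivity
  have hwsucc : ∀ l, w l = w (l + 1) * (2 * b) := fun l => by
    simp only [hw, pow_succ]; field_simp
  have hcs : ∀ d l j, corner ι d (l + 1) j = corner ι d l j +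
      w (l + 1) * (2 * (ι l (corner ι d l) (d l) j : ℕ)) := fun d l j => rfl
  have hmono : ∀ d j, Monotone fun l => corner ι d l j := by
    intro d j
    refine monotone_nat_of_le_succ fun l => ?_
    rw [hcs]
    have := hwpos (l + 1)
    have : (0 : ℝ) ≤ w (l + 1) * (2 * (ι l (corner ι d l) (d l) j : ℕ)) := by positivity
    linarith
  have hanti : ∀ d j, Antitone fun l => corner ι d l j + w l := by
    intro d j
    refine antitone_nat_of_succ_le fun l => ?_
    rw [hcs, hwsucc l]
    have h1 := hwpos (l + 1)
    have h2 : ((ι l (corner ι d l) (d l) j : ℕ) : ℝ) + 1 ≤ b := by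
      exact_mod_cast (ι l (corner ι d l) (d l) j).2
    nlinarith
  let φ : (ℕ → Fin K) → (Fin n → ℝ) := fun d j => ⨆ l, corner ι d l j
  have hφ : ∀ d j l, corner ι d l j ≤ φ d j ∧ φ d j ≤ corner ι d l j + w l := by
    intro d j l
    have := (hmono d j).ciSup_mem_iInter_Icc_of_antitone (hanti d j)
      (fun l => by simp [(hwpos l).le])
    exact Set.mem_iInter.1 this l
  have hsub : Set.range φ ⊆ {α : Fin n → ℝ | (∀ j, α j ∈ Set.Ico (0 : ℝ) 1) ∧
      ∀ l (p : ℤ) j, |u l j| * ((2 * b : ℝ) ^ (l + 1))⁻¹ ≤ |∑ j, u l j * α j - p|} := by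
    rintro _ ⟨d, rfl⟩
    refine ⟨fun j => ⟨?_, ?_⟩, fun l p j => ?_⟩
    · have := (hφ d j 0).1
      simpa [corner] using this
    · have h0 := (hφ d j 1).2
      rw [hcs] at h0
      have h1 := hwpos 1
      have h2 : ((ι 0 (corner ι d 0) (d 0) j : ℕ) : ℝ) + 1 ≤ b := by
        exact_mod_cast (ι 0 (corner ι d 0) (d 0) j).2
      have h3 : w 0 = 1 := by simp [hw]
      have h4 := hwsucc 0
      have h5 : corner ι d 0 j = 0 := rfl
      rw [h5] at h0
      rw [h3] at h4
      simp only [zero_add] at h0 h4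
      nlinarith
    · refine hι l (corner ι d l) (d l) (φ d) (fun j => ?_) p j
      have := hφ d j (l + 1)
      rw [hcs] at this
      exact this
  refine le_trans ?_ (dimH_mono hsub)
  refine dimH_of_param r hr0 (K : NNReal) φ (fun d => Real.ofDigits d) ?_ ?_
  · intro y hy
    have : NeZero K := ⟨by omega⟩
    exact ⟨Real.digits y K, Real.ofDigits_digits (by omega) hy⟩
  · intro d d'
    by_cases hdd : d = d'
    · subst hdd; simp
    classical
    have hex : ∃ l, d l ≠ d' l := by
      by_contra h; push Not at h; exact hdd (funext h)
    let l := Nat.find hex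
    have hl : d l ≠ d' l := Nat.find_spec hex
    have hlt : ∀ i < l, d i = d' i := fun i hi => not_not.1 (Nat.find_min hex hi)
    have hcc := corner_congr ι d d' l hlt
    have hne : ι l (corner ι d l) (d l) ≠ ι l (corner ι d l) (d' l) :=
      fun h => hl (hinj l _ h)
    obtain ⟨j, hj⟩ := Function.ne_iff.1 hne
    have hj' : (ι l (corner ι d l) (d l) j : ℕ) ≠ ι l (corner ι d l) (d' l) j :=
      fun h => hj (Fin.ext h)
    have hdist : w (l + 1) ≤ dist (φ d) (φ d') := by
      refine le_trans ?_ (dist_le_pi_dist (φ d) (φ d') j)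
      rw [Real.dist_eq]
      have h1 := hφ d j (l + 1)
      have h2 := hφ d' j (l + 1)
      rw [hcs] at h1 h2
      rw [← hcc] at h2
      have hw1 := hwpos (l + 1)
      rcases lt_or_gt_of_ne hj' with h | h
      · have h3 : ((ι l (corner ι d l) (d l) j : ℕ) : ℝ) + 1 ≤ (ι l (corner ι d l) (d' l) j : ℕ) := by
          exact_mod_cast h
        rw [abs_sub_comm]
        refine le_trans ?_ (le_abs_self _)
        nlinarith
      · have h3 : ((ι l (corner ι d l) (d' l) j : ℕ) : ℝ) + 1 ≤ (ι l (corner ι d l) (d l) j : ℕ) := by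
          exact_mod_cast h
        refine le_trans ?_ (le_abs_self _)
        nlinarith
    have hψ : dist (Real.ofDigits d) (Real.ofDigits d') ≤ K * dist (φ d) (φ d') ^ (r : ℝ) := by
      have h1 : dist (Real.ofDigits d) (Real.ofDigits d') ≤ ((K : ℝ) ^ l)⁻¹ :=
        Real.abs_ofDigits_sub_ofDigits_le hlt
      have h2 : w (l + 1) ^ (r : ℝ) ≤ dist (φ d) (φ d') ^ (r : ℝ) :=
        Real.rpow_le_rpow (hwpos _).le hdist r.2
      have h3 : w (l + 1) ^ (r : ℝ) = ((K : ℝ) ^ (l + 1))⁻¹ := by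
        simp only [hw]
        rw [Real.inv_rpow (by positivity), ← Real.rpow_natCast, ← Real.rpow_mul hβ.le,
          mul_comm _ (r : ℝ), Real.rpow_mul hβ.le, hr, Real.rpow_natCast]
      have hK0 : (0 : ℝ) < K := by exact_mod_cast (by omega : 0 < K)
      calc _ ≤ ((K : ℝ) ^ l)⁻¹ := h1
        _ = K * ((K : ℝ) ^ (l + 1))⁻¹ := by rw [pow_succ]; field_simp
        _ ≤ _ := by rw [← h3]; exact mul_le_mul_of_nonneg_left h2 hK0.le
    rw [edist_dist, edist_dist, ENNReal.ofReal_rpow_of_nonneg (p := (r : ℝ)) dist_nonneg r.coe_nonneg]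
    refine (ENNReal.ofReal_le_ofReal hψ).trans ?_
    rw [ENNReal.ofReal_mul (Nat.cast_nonneg _)]
    simp

lemma le_snorm {d : ℕ} (q : Fin d → ℤ) (i : Fin d) : |(q i : ℝ)| ≤ snorm q :=
  le_ciSup (f := fun i => |(q i : ℝ)|) (Set.finite_range _).bddAbove i

lemma snorm_le {d : ℕ} (hd : 0 < d) (q : Fin d → ℤ) (B : ℝ) (h : ∀ i, |(q i : ℝ)| ≤ B) :
    snorm q ≤ B := by
  have : Nonempty (Fin d) := ⟨⟨0, hd⟩⟩
  exact ciSup_le h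

lemma one_le_snorm {d : ℕ} (q : Fin d → ℤ) (h : q ≠ 0) : 1 ≤ snorm q := by
  obtain ⟨i, hi⟩ := Function.ne_iff.1 h
  refine le_trans ?_ (le_snorm q i)
  exact_mod_cast Int.one_le_abs hi

lemma dual_vec {n m : ℕ} (hn : 0 < n) (hm : 0 < m) (k : Fin n → ℝ) (hk : ∀ j, 0 < k j)
    (hksum : ∑ j, k j = 1) (L : Matrix (Fin n) (Fin m) ℝ) (hL : badForm k L) :
    ∃ C : ℝ, 1 ≤ C ∧ ∃ δ : ℝ, 0 < δ ∧ ∃ Q0 : ℝ, 1 ≤ Q0 ∧ ∀ Q : ℝ, Q0 ≤ Q → ∀ s : Fin n,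
      ∃ (u : Fin n → ℤ) (v : Fin m → ℤ),
        (∀ j, |(u j : ℝ)| ≤ C * Q ^ ((m : ℝ) * k j)) ∧
        (∀ i, |(v i : ℝ) + ∑ j, (u j : ℝ) * L j i| ≤ C / Q) ∧
        δ * Q ^ ((m : ℝ) * k s) ≤ |(u s : ℝ)| := by
  obtain ⟨ε, hε, hbad⟩ := hL
  have hm' : (0 : ℝ) < m := by exact_mod_cast hm
  have hn' : (0 : ℝ) < n := by exact_mod_cast hn
  set e := min ε 1 with he
  have he0 : 0 < e := lt_min hε one_pos
  set T : ℕ := ⌈(2 : ℝ) ^ n * (2 * (m + n) / e + 3) ^ (m + n - 1)⌉₊ + 1 with hT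
  have hT1 : 1 ≤ T := by omega
  have hTbig : (2 : ℝ) ^ n * (2 * (m + n) / e + 3) ^ (m + n - 1) < (T : ℝ) := by
    rw [hT]; push_cast
    exact lt_of_le_of_lt (Nat.le_ceil _) (lt_add_one _)
  have hT1' : (1 : ℝ) ≤ T := by exact_mod_cast hT1
  have hev : ∀ᶠ Q : ℝ in Filter.atTop, ∀ j, (T : ℝ) ≤ Q ^ ((m : ℝ) * k j) :=
    Filter.eventually_all.2 fun j =>
      (tendsto_rpow_atTop (mul_pos hm' (hk j))).eventually_ge_atTop _
  obtain ⟨Q0, hQ0⟩ := Filter.eventually_atTop.1 hev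
  refine ⟨(m + n).factorial * (T : ℝ) ^ (m + n), ?_, 1 / ((m + n) * T), by positivity,
    max Q0 1, le_max_right _ _, ?_⟩
  · have h1 : (1 : ℝ) ≤ (m + n).factorial := by exact_mod_cast Nat.succ_le_of_lt (Nat.factorial_pos _)
    exact one_le_mul_of_one_le_of_one_le h1 (one_le_pow₀ hT1')
  intro Q hQ s
  have hQ1 : 1 ≤ Q := (le_max_right _ _).trans hQ
  have hQpos : 0 < Q := by linarith
  have hD := hQ0 Q ((le_max_left _ _).trans hQ)
  have hprod : ∏ j, Q ^ ((m : ℝ) * k j) = Q ^ m := by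
    rw [← Real.rpow_sum_of_pos hQpos, ← Finset.mul_sum, hksum, mul_one, Real.rpow_natCast]
  have hD0 : ∀ j, 0 < Q ^ ((m : ℝ) * k j) := fun j => Real.rpow_pos_of_pos hQpos _
  have hnz : ∀ z : Fin m ⊕ Fin n → ℤ,
      (∀ a, |sc L Q (fun j => Q ^ ((m : ℝ) * k j)) z a| < e) → z = 0 := by
    intro z hz
    have hq0 : (fun i => z (Sum.inl i)) = 0 := by
      by_contra hq
      have hle : snorm (fun i => z (Sum.inl i)) ≤ Q := by
        refine snorm_le hm _ _ fun i => ?_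
        have h1 := hz (Sum.inl i)
        simp only [sc, Sum.elim_inl] at h1
        rw [abs_mul, abs_of_pos (inv_pos.2 hQpos), inv_mul_lt_iff₀ hQpos] at h1
        have : e ≤ 1 := min_le_right _ _
        nlinarith
      obtain ⟨j, hj⟩ := hbad _ hq
      have h1 := hz (Sum.inr j)
      simp only [sc, Sum.elim_inr] at h1
      rw [abs_mul, abs_of_pos (hD0 j)] at h1
      have h2 : dni (∑ i, (z (Sum.inl i) : ℝ) * L j i)
          ≤ |(∑ i, (z (Sum.inl i) : ℝ) * L j i) - z (Sum.inr j)| := round_le _ _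
      have h3 : snorm (fun i => z (Sum.inl i)) ^ ((m : ℝ) * k j) ≤ Q ^ ((m : ℝ) * k j) :=
        Real.rpow_le_rpow (by linarith [one_le_snorm _ hq]) hle (mul_pos hm' (hk j)).le
      have h4 := mul_le_mul h3 h2 (abs_nonneg _) (hD0 j).le
      have h5 : e ≤ ε := min_le_left _ _
      linarith
    funext a
    rcases a with i | j
    · exact congrFun hq0 i
    · have h1 := hz (Sum.inr j)
      have hq0' : ∀ i, z (Sum.inl i) = 0 := fun i => congrFun hq0 i
      simp only [sc, Sum.elim_inr, hq0', Int.cast_zero, zero_mul, Finset.sum_const_zero, zero_sub,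
        mul_neg, abs_neg] at h1
      rw [abs_mul, abs_of_pos (hD0 j)] at h1
      have h2 : |(z (Sum.inr j) : ℝ)| < 1 := by
        have : e ≤ 1 := min_le_right _ _
        have h3 : 1 ≤ Q ^ ((m : ℝ) * k j) := hT1'.trans (hD j)
        nlinarith [abs_nonneg (z (Sum.inr j) : ℝ)]
      have h3 : |z (Sum.inr j)| < 1 := by exact_mod_cast h2
      exact Int.abs_lt_one_iff.1 h3
  exact dual_of_span L Q (fun j => Q ^ ((m : ℝ) * k j)) hQpos hprod hD0 T hT1'
    (fun f hf => no_hyperplane hn L Q _ hQpos hprod T hT1 hD e he0 hnz hTbig f hf) s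

lemma mem_twisted {n m : ℕ} (hn : 0 < n) (hm : 0 < m) (k : Fin n → ℝ) (hk : ∀ j, 0 < k j)
    (hksum : ∑ j, k j = 1) (L : Matrix (Fin n) (Fin m) ℝ) (α : Fin n → ℝ)
    (hα : ∀ j, α j ∈ Set.Ico (0 : ℝ) 1) (C c R : ℝ) (hC : 1 ≤ C) (hc : 0 < c) (hR : 1 ≤ R)
    (H : ∀ Y : ℝ, 1 ≤ Y → ∃ Q, Y ≤ Q ∧ Q ≤ R * Y ∧ ∃ (u : Fin n → ℤ) (v : Fin m → ℤ),
        (∀ j, |(u j : ℝ)| ≤ C * Q ^ ((m : ℝ) * k j)) ∧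
        (∀ i, |(v i : ℝ) + ∑ j, (u j : ℝ) * L j i| ≤ C / Q) ∧
        ∀ p : ℤ, c ≤ |∑ j, (u j : ℝ) * α j - p|) :
    α ∈ badTwisted k L := by
  have hm' : (0 : ℝ) < m := by exact_mod_cast hm
  have hn' : (0 : ℝ) < n := by exact_mod_cast hn
  have hne : Nonempty (Fin n) := ⟨⟨0, hn⟩⟩
  set Γ := max 1 (2 * m * C / c) with hΓ
  have hΓ1 : 1 ≤ Γ := le_max_left _ _
  have hRΓ : 1 ≤ R * Γ := one_le_mul_of_one_le_of_one_le hR hΓ1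
  refine ⟨hα, c / (2 * n * C) * ((R * Γ) ^ m)⁻¹, by positivity, ?_⟩
  intro q hq
  by_contra hcon
  push Not at hcon
  set X := snorm q with hX
  have hX1 : 1 ≤ X := one_le_snorm q hq
  obtain ⟨Q, hQl, hQu, u, v, hu, hv, hp⟩ := H (Γ * X) (one_le_mul_of_one_le_of_one_le hΓ1 hX1)
  have hQ1 : 1 ≤ Q := (one_le_mul_of_one_le_of_one_le hΓ1 hX1).trans hQl
  have hQpos : 0 < Q := by linarith
  set y : Fin n → ℝ := fun j => (∑ i, (q i : ℝ) * L j i) - α j with hy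
  have hk1 : ∀ j, k j ≤ 1 := fun j => by
    rw [← hksum]; exact Finset.single_le_sum (fun j _ => (hk j).le) (Finset.mem_univ j)
  have hsmall : ∀ j, Q ^ ((m : ℝ) * k j) * dni (y j) < c / (2 * n * C) := by
    intro j
    have h1 := hcon j
    have h2 : Q ^ ((m : ℝ) * k j) ≤ (R * Γ) ^ m * X ^ ((m : ℝ) * k j) := by
      have hmk := (mul_pos hm' (hk j)).le
      calc Q ^ ((m : ℝ) * k j) ≤ ((R * Γ) * X) ^ ((m : ℝ) * k j) :=
            Real.rpow_le_rpow hQpos.le (by linarith) hmk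
        _ = (R * Γ) ^ ((m : ℝ) * k j) * X ^ ((m : ℝ) * k j) :=
            Real.mul_rpow (by linarith) (by linarith)
        _ ≤ _ := by
            refine mul_le_mul_of_nonneg_right ?_ (Real.rpow_nonneg (by linarith) _)
            rw [← Real.rpow_natCast]
            exact Real.rpow_le_rpow_of_exponent_le hRΓ (by nlinarith [hk1 j])
    have h3 : 0 ≤ dni (y j) := abs_nonneg _
    have hpow : 0 < (R * Γ) ^ m := by positivity
    calc _ ≤ ((R * Γ) ^ m * X ^ ((m : ℝ) * k j)) * dni (y j) := mul_le_mul_of_nonneg_right h2 h3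
      _ = (R * Γ) ^ m * (X ^ ((m : ℝ) * k j) * dni (y j)) := by ring
      _ < (R * Γ) ^ m * (c / (2 * n * C) * ((R * Γ) ^ m)⁻¹) := mul_lt_mul_of_pos_left h1 hpow
      _ = _ := by field_simp
  have hkey := hp (-(∑ j, u j * round (y j)) - ∑ i, q i * v i)
  have hid : (∑ j, (u j : ℝ) * α j) - ((-(∑ j, u j * round (y j)) - ∑ i, q i * v i : ℤ) : ℝ)
      = ∑ i, (q i : ℝ) * (v i + ∑ j, (u j : ℝ) * L j i)
        - ∑ j, (u j : ℝ) * (y j - round (y j)) := by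
    push_cast
    have h1 : ∑ i, (q i : ℝ) * ∑ j, (u j : ℝ) * L j i = ∑ j, (u j : ℝ) * ∑ i, (q i : ℝ) * L j i := by
      simp only [Finset.mul_sum]
      rw [Finset.sum_comm]
      refine Finset.sum_congr rfl fun j _ => Finset.sum_congr rfl fun i _ => by ring
    have h2 : ∀ j, (u j : ℝ) * (y j - round (y j))
        = (u j : ℝ) * (∑ i, (q i : ℝ) * L j i) - u j * α j - u j * round (y j) := by
      intro j; simp only [hy]; ring
    simp only [h2, mul_add, Finset.sum_add_distrib, Finset.sum_sub_distrib, h1]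
    ring
  rw [hid] at hkey
  have hb1 : |∑ i, (q i : ℝ) * (v i + ∑ j, (u j : ℝ) * L j i)| ≤ c / 2 := by
    calc _ ≤ ∑ i, |(q i : ℝ) * (v i + ∑ j, (u j : ℝ) * L j i)| := Finset.abs_sum_le_sum_abs _ _
      _ ≤ ∑ i : Fin m, X * (C / Q) := by
          refine Finset.sum_le_sum fun i _ => ?_
          rw [abs_mul]
          exact mul_le_mul (le_snorm q i) (hv i) (abs_nonneg _) (by linarith)
      _ = m * (X * (C / Q)) := by simp
      _ ≤ c / 2 := by
          have h1 : 2 * m * C / c ≤ Γ := le_max_right _ _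
          rw [div_le_iff₀ hc] at h1
          rw [show (m : ℝ) * (X * (C / Q)) = m * X * C / Q by ring, div_le_iff₀ hQpos]
          nlinarith
  have hb2 : |∑ j, (u j : ℝ) * (y j - round (y j))| < c / 2 := by
    calc _ ≤ ∑ j, |(u j : ℝ) * (y j - round (y j))| := Finset.abs_sum_le_sum_abs _ _
      _ < ∑ j : Fin n, C * (c / (2 * n * C)) := by
          refine Finset.sum_lt_sum_of_nonempty Finset.univ_nonempty fun j _ => ?_
          rw [abs_mul]
          calc _ ≤ (C * Q ^ ((m : ℝ) * k j)) * dni (y j) :=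
                mul_le_mul_of_nonneg_right (hu j) (abs_nonneg _)
            _ = C * (Q ^ ((m : ℝ) * k j) * dni (y j)) := by ring
            _ < _ := mul_lt_mul_of_pos_left (hsmall j) (by linarith)
      _ = c / 2 := by
          simp only [Finset.sum_const, Finset.card_univ, Fintype.card_fin, nsmul_eq_mul]
          have : C ≠ 0 := by linarith
          field_simp
  have := abs_sub (∑ i, (q i : ℝ) * (v i + ∑ j, (u j : ℝ) * L j i))
    (∑ j, (u j : ℝ) * (y j - round (y j)))
  linarith

lemma exists_schedule : ∃ τ : ℕ → ℕ, ∀ t, ∃ G : ℕ, ∀ N, ∃ l, N ≤ l ∧ l ≤ N + G ∧ τ l = t := by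
  refine ⟨fun l => padicValNat 2 (l + 1), fun t => ⟨2 ^ (t + 2), fun N => ?_⟩⟩
  set w := N / 2 ^ (t + 1) + 1 with hw
  have hpos : 0 < 2 ^ t := by positivity
  have h1 := Nat.div_add_mod N (2 ^ (t + 1))
  have h2 := Nat.mod_lt N (show 0 < 2 ^ (t + 1) by positivity)
  have e1 : 2 ^ (t + 1) * w = 2 ^ (t + 1) * (N / 2 ^ (t + 1)) + 2 ^ (t + 1) := by rw [hw]; ring
  have e2 : 2 ^ (t + 1) = 2 * 2 ^ t := by ring
  have e3 : 2 ^ (t + 2) = 4 * 2 ^ t := by ring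
  have e4 : 2 ^ t * (2 * w + 1) = 2 ^ (t + 1) * w + 2 ^ t := by ring
  refine ⟨2 ^ t * (2 * w + 1) - 1, by omega, by omega, ?_⟩
  have e5 : 2 ^ t * (2 * w + 1) - 1 + 1 = 2 ^ t * (2 * w + 1) := by omega
  show padicValNat 2 (2 ^ t * (2 * w + 1) - 1 + 1) = t
  rw [e5, padicValNat.mul hpos.ne' (by omega), padicValNat.prime_pow,
    padicValNat.eq_zero_of_not_dvd (by omega), add_zero]

lemma exists_subset_dim (n m : ℕ) (hn : 0 < n) (hm : 0 < m)
    (k : ℕ → Fin n → ℝ) (hk : ∀ t j, 0 < k t j) (hksum : ∀ t, ∑ j, k t j = 1)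
    (L : Matrix (Fin n) (Fin m) ℝ) (hL : ∀ t, badForm (k t) L)
    (b K : ℕ) (hb : 2 ≤ b) (hK2 : 2 ≤ K)
    (hK : K + (n + 1) * b ^ (n - 1) ≤ b ^ n) (r : NNReal) (hr0 : 0 < r)
    (hr : (2 * b : ℝ) ^ (r : ℝ) = K) :
    (r : ENNReal) ≤ dimH (⋂ t : ℕ, badTwisted (k t) L) := by
  have hm' : (0 : ℝ) < m := by exact_mod_cast hm
  have hn' : (0 : ℝ) < n := by exact_mod_cast hn
  have hb' : (2 : ℝ) ≤ b := by exact_mod_cast hb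
  have hne : Nonempty (Fin n) := ⟨⟨0, hn⟩⟩
  choose C hC δ hδ Q0 hQ0 hdual using fun t => dual_vec hn hm (k t) (hk t) (hksum t) L (hL t)
  choose s hs using fun t => Finite.exists_max (k t)
  obtain ⟨τ, hτ⟩ := exists_schedule
  set β : ℝ := 2 * b with hβ
  have hβ1 : 1 < β := by linarith
  have hβ0 : 0 < β := by linarith
  set θ : ℕ → ℝ := fun t => (m : ℝ) * k t (s t) with hθ
  have hθ0 : ∀ t, 0 < θ t := fun t => mul_pos hm' (hk _ _)
  let Qf : ℕ → ℕ → ℝ := fun t l => (β ^ l / (2 * n * C t)) ^ (θ t)⁻¹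
  have hCp : ∀ t, 0 < 2 * n * C t := fun t => by have := hC t; positivity
  have hQf : ∀ t l, Qf t l ^ θ t = β ^ l / (2 * n * C t) := fun t l =>
    Real.rpow_inv_rpow (div_pos (by positivity) (hCp t)).le (hθ0 t).ne'
  have hQfp : ∀ t l, 0 < Qf t l := fun t l =>
    Real.rpow_pos_of_pos (div_pos (by positivity) (hCp t)) _
  have hlev : ∀ l, ∃ u : Fin n → ℤ, (∑ j, |(u j : ℝ)|) ≤ β ^ l / 2 ∧
      (Q0 (τ l) ≤ Qf (τ l) l → ∃ v : Fin m → ℤ,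
        (∀ j, |(u j : ℝ)| ≤ C (τ l) * Qf (τ l) l ^ ((m : ℝ) * k (τ l) j)) ∧
        (∀ i, |(v i : ℝ) + ∑ j, (u j : ℝ) * L j i| ≤ C (τ l) / Qf (τ l) l) ∧
        δ (τ l) * Qf (τ l) l ^ (θ (τ l)) ≤ |(u (s (τ l)) : ℝ)|) := by
    intro l
    by_cases h : Q0 (τ l) ≤ Qf (τ l) l
    · obtain ⟨u, v, h1, h2, h3⟩ := hdual (τ l) _ h (s (τ l))
      refine ⟨u, ?_, fun _ => ⟨v, h1, h2, h3⟩⟩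
      have hQ1 : 1 ≤ Qf (τ l) l := (hQ0 _).trans h
      calc ∑ j, |(u j : ℝ)| ≤ ∑ j : Fin n, C (τ l) * (β ^ l / (2 * n * C (τ l))) := by
            refine Finset.sum_le_sum fun j _ => (h1 j).trans ?_
            rw [← hQf]
            refine mul_le_mul_of_nonneg_left ?_ (by linarith [hC (τ l)])
            exact Real.rpow_le_rpow_of_exponent_le hQ1
              (mul_le_mul_of_nonneg_left (hs (τ l) j) hm'.le)
        _ = β ^ l / 2 := by
            simp only [Finset.sum_const, Finset.card_univ, Fintype.card_fin, nsmul_eq_mul]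
            have : C (τ l) ≠ 0 := by linarith [hC (τ l)]
            field_simp
    · exact ⟨0, by simp; positivity, fun h' => absurd h' h⟩
  choose u husum hu using hlev
  refine (cantor_dim n hn b K hb hK2 hK r hr0 hr (fun l j => (u l j : ℝ)) husum).trans
    (dimH_mono ?_)
  rintro α ⟨hα, hαu⟩
  refine Set.mem_iInter.2 fun t => ?_
  obtain ⟨G, hG⟩ := hτ t
  set W : ℝ := (β ^ (G + 1)) ^ (θ t)⁻¹ with hW
  have hW1 : 1 ≤ W := Real.one_le_rpow (one_le_pow₀ hβ1.le) (inv_pos.2 (hθ0 t)).le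
  refine mem_twisted hn hm (k t) (hk t) (hksum t) L α hα (C t) (δ t / (2 * n * C t * β))
    (W * Q0 t) (hC t) (div_pos (hδ t) (mul_pos (hCp t) hβ0))
    (one_le_mul_of_one_le_of_one_le hW1 (hQ0 t)) ?_
  intro Y hY
  have hY1 : 1 ≤ Q0 t * Y := one_le_mul_of_one_le_of_one_le (hQ0 t) hY
  have hYθ : 1 ≤ (Q0 t * Y) ^ θ t := Real.one_le_rpow hY1 (hθ0 t).le
  have hC1 : 1 ≤ 2 * n * C t := by
    have h1 : (1 : ℝ) ≤ n := by exact_mod_cast hn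
    nlinarith [hC t]
  obtain ⟨N, hN1, hN2⟩ := exists_nat_pow_near (one_le_mul_of_one_le_of_one_le hC1 hYθ) hβ1
  obtain ⟨l, hl1, hl2, hl3⟩ := hG (N + 1)
  have hQlow : Q0 t * Y ≤ Qf t l := by
    rw [← Real.rpow_le_rpow_iff (by linarith) (hQfp t l).le (hθ0 t), hQf,
      le_div_iff₀ (hCp t)]
    have : β ^ (N + 1) ≤ β ^ l := pow_le_pow_right₀ hβ1.le hl1
    linarith
  have hQup : Qf t l ≤ W * (Q0 t * Y) := by
    rw [← Real.rpow_le_rpow_iff (hQfp t l).le (by positivity) (hθ0 t), hQf,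
      Real.mul_rpow (by positivity) (by linarith), hW,
      Real.rpow_inv_rpow (by positivity) (hθ0 t).ne', div_le_iff₀ (hCp t)]
    calc β ^ l ≤ β ^ (N + 1 + G) := pow_le_pow_right₀ hβ1.le hl2
      _ = β ^ (G + 1) * β ^ N := by rw [← pow_add]; congr 1; omega
      _ ≤ β ^ (G + 1) * (2 * n * C t * (Q0 t * Y) ^ θ t) :=
          mul_le_mul_of_nonneg_left hN1 (by positivity)
      _ = _ := by ring
  subst hl3
  have hge : Q0 (τ l) ≤ Qf (τ l) l := by
    refine le_trans ?_ hQlow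
    nlinarith [hQ0 (τ l)]
  obtain ⟨v, h1, h2, h3⟩ := hu l hge
  refine ⟨Qf (τ l) l, ?_, by linarith, u l, v, h1, h2, fun p => ?_⟩
  · refine le_trans ?_ hQlow
    nlinarith [hQ0 (τ l)]
  · refine le_trans ?_ (hαu l p (s (τ l)))
    rw [hQf] at h3
    calc _ = (δ (τ l) * (β ^ l / (2 * n * C (τ l)))) * (β ^ (l + 1))⁻¹ := by
          have h4 := (hCp (τ l)).ne'
          rw [pow_succ]
          field_simp
      _ ≤ _ := mul_le_mul_of_nonneg_right h3 (by positivity)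

/-- For a sequence of weight vectors `k_t` and a matrix `L`
belonging to `Bad(k_t, n, m)` for every `t`, the countable intersection
`⋂_t Bad_L(k_t, n, m)` has full Hausdorff dimension `n`. -/
theorem badTwisted_iInter_dimH_eq (n m : ℕ) (hn : 0 < n) (hm : 0 < m)
    (k : ℕ → Fin n → ℝ) (hk : ∀ t j, 0 < k t j) (hksum : ∀ t, ∑ j, k t j = 1)
    (L : Matrix (Fin n) (Fin m) ℝ) (hL : ∀ t, badForm (k t) L) :
    dimH (⋂ t : ℕ, badTwisted (k t) L) = n := by
  apply le_antisymm
  · exact (dimH_mono (Set.subset_univ _)).trans (Real.dimH_univ_pi_fin n).le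
  refine ENNReal.le_of_forall_nnreal_lt fun d hd => ?_
  have hd' : (d : ℝ) < n := by
    have : d < (n : NNReal) := by exact_mod_cast hd
    exact_mod_cast this
  have hgap : 0 < (n : ℝ) - d := by linarith
  obtain ⟨a0, ha0⟩ := exists_nat_gt (((n : ℝ) + 1) / (n - d))
  set a := max a0 (n + 1) with ha
  have ha1 : n + 1 ≤ a := le_max_right _ _
  have ha2 : (a0 : ℝ) ≤ a := by exact_mod_cast le_max_left _ _
  have han : 2 ≤ a * n := by nlinarith
  have hanR : (2 : ℝ) ≤ (a : ℝ) * n := by exact_mod_cast han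
  have hra : (0 : ℝ) < ((a : ℝ) * n - 1) / (a + 1) := div_pos (by linarith) (by positivity)
  obtain ⟨r, hr⟩ : ∃ r : NNReal, (r : ℝ) = ((a : ℝ) * n - 1) / (a + 1) :=
    ⟨Real.toNNReal _, Real.coe_toNNReal _ hra.le⟩
  have hr0 : 0 < r := by
    rw [← NNReal.coe_pos, hr]
    exact hra
  have key := exists_subset_dim n m hn hm k hk hksum L hL (2 ^ a) (2 ^ (a * n - 1))
    (by calc 2 = 2 ^ 1 := rfl
          _ ≤ 2 ^ a := Nat.pow_le_pow_right (by norm_num) (by omega))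
    (by calc 2 = 2 ^ 1 := rfl
          _ ≤ 2 ^ (a * n - 1) := Nat.pow_le_pow_right (by norm_num) (by omega))
    (by
      have e1 : (2 ^ a) ^ (n - 1) * 2 ^ (a - 1) = 2 ^ (a * n - 1) := by
        rw [← pow_mul, ← pow_add]
        congr 1
        obtain ⟨n', rfl⟩ : ∃ n', n = n' + 1 := ⟨n - 1, by omega⟩
        rw [Nat.add_sub_cancel, Nat.mul_succ]
        omega
      have e2 : (2 ^ a) ^ n = 2 * 2 ^ (a * n - 1) := by
        rw [← pow_mul, ← pow_succ']
        congr 1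
        omega
      have e3 : n + 1 ≤ 2 ^ (a - 1) := by
        have := Nat.lt_two_pow_self (n := a - 1)
        omega
      have e4 : (n + 1) * (2 ^ a) ^ (n - 1) ≤ 2 ^ (a * n - 1) := by
        rw [← e1, mul_comm]
        exact Nat.mul_le_mul_left _ e3
      omega)
    r hr0 (by
      have e1 : (2 * ((2 ^ a : ℕ) : ℝ)) = (2 : ℝ) ^ ((a : ℝ) + 1) := by
        rw [Real.rpow_add (by norm_num), Real.rpow_natCast, Real.rpow_one]
        push_cast
        ring
      rw [hr, e1, ← Real.rpow_mul (by norm_num)]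
      push_cast
      rw [← Real.rpow_natCast, Nat.cast_sub (by omega)]
      congr 1
      have : (a : ℝ) + 1 ≠ 0 := by positivity
      push_cast
      field_simp)
  refine le_trans (ENNReal.coe_le_coe.2 ?_) key
  rw [← NNReal.coe_le_coe, hr, le_div_iff₀ (by positivity)]
  rw [div_lt_iff₀ hgap] at ha0
  have h3 := mul_le_mul_of_nonneg_right ha2 hgap.le
  nlinarith
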